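/- Let Ω ⊆ ℝ³ be open, n : Ω → ℂ continuous, κ ∈ ℝ, and let E₁, E₂ ∈ C²(Ω;ℂ³) satisfy ∇×(∇×E_j) = κ² n E_j in Ω for j = 1, 2. Let L ∈ C²(Ω;ℂ) be nowhere vanishing and set H_j := L E_j. Define β := [(∇H₁)H₂ − (∇H₂)H₁] + [(∇·H₁)H₂ − (∇·H₂)H₁] − 2[(∇H₁)ᵀH₂ − (∇H₂)ᵀH₁] and γ := [∇(∇·H₁)·H₂ − ∇(∇·H₂)·H₁] − [ΔH₁·H₂ − ΔH₂·H₁]. Then the transport identity β·∇L = γ L holds at every point of Ω. -/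

import Mathlib

open scoped BigOperators

/-- Partial derivative (in direction `i`) of a complex-valued function on `ℝ³`. -/
noncomputable def pdC (f : (Fin 3 → ℝ) → ℂ) (i : Fin 3) (x : Fin 3 → ℝ) : ℂ :=
  fderiv ℝ f x (Pi.single i 1)

/-- Euclidean Laplacian of a complex-valued function on `ℝ³`. -/
noncomputable def lapC (f : (Fin 3 → ℝ) → ℂ) (x : Fin 3 → ℝ) : ℂ :=
  ∑ i, pdC (pdC f i) i x

/-- Curl of a `ℂ³`-valued field on `ℝ³`. -/
noncomputable def curlC (E : (Fin 3 → ℝ) → Fin 3 → ℂ) (x : Fin 3 → ℝ) : Fin 3 → ℂ :=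
  ![pdC (fun y => E y 2) 1 x - pdC (fun y => E y 1) 2 x,
    pdC (fun y => E y 0) 2 x - pdC (fun y => E y 2) 0 x,
    pdC (fun y => E y 1) 0 x - pdC (fun y => E y 0) 1 x]

/-- Divergence of a `ℂ³`-valued field on `ℝ³`. -/
noncomputable def divC (H : (Fin 3 → ℝ) → Fin 3 → ℂ) (x : Fin 3 → ℝ) : ℂ :=
  ∑ i, pdC (fun y => H y i) i x

/-- The vector field `β = [(∇H₁)H₂ − (∇H₂)H₁] + [(∇·H₁)H₂ − (∇·H₂)H₁]
−2[(∇H₁)ᵀH₂ − (∇H₂)ᵀH₁]` of electro-seismic conversion. -/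
noncomputable def esBeta (H₁ H₂ : (Fin 3 → ℝ) → Fin 3 → ℂ) (x : Fin 3 → ℝ) : Fin 3 → ℂ :=
  fun i =>
    ((∑ k, pdC (fun y => H₁ y i) k x * H₂ x k) - (∑ k, pdC (fun y => H₂ y i) k x * H₁ x k))
    + (divC H₁ x * H₂ x i - divC H₂ x * H₁ x i)
    - 2 * ((∑ k, pdC (fun y => H₁ y k) i x * H₂ x k)
        - (∑ k, pdC (fun y => H₂ y k) i x * H₁ x k))

/-- The scalar field `γ = [∇(∇·H₁)·H₂ − ∇(∇·H₂)·H₁] − [ΔH₁·H₂ − ΔH₂·H₁]`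
of electro-seismic conversion. -/
noncomputable def esGamma (H₁ H₂ : (Fin 3 → ℝ) → Fin 3 → ℂ) (x : Fin 3 → ℝ) : ℂ :=
  ((∑ i, pdC (divC H₁) i x * H₂ x i) - (∑ i, pdC (divC H₂) i x * H₁ x i))
    - ((∑ i, lapC (fun y => H₁ y i) x * H₂ x i)
        - (∑ i, lapC (fun y => H₂ y i) x * H₁ x i))

theorem pdC_congr {f g : (Fin 3 → ℝ) → ℂ} {Ω : Set (Fin 3 → ℝ)} (hΩ : IsOpen Ω)
    (h : ∀ y ∈ Ω, f y = g y) (i : Fin 3) {x : Fin 3 → ℝ} (hx : x ∈ Ω) :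
    pdC f i x = pdC g i x := by
  unfold pdC
  have : f =ᶠ[nhds x] g := Filter.eventuallyEq_of_mem (hΩ.mem_nhds hx) h
  rw [this.fderiv_eq]

theorem pdC_mul {f g : (Fin 3 → ℝ) → ℂ} {x : Fin 3 → ℝ} (hf : DifferentiableAt ℝ f x)
    (hg : DifferentiableAt ℝ g x) (i : Fin 3) :
    pdC (fun y => f y * g y) i x = pdC f i x * g x + f x * pdC g i x := by
  unfold pdC
  rw [fderiv_fun_mul hf hg]
  simp
  ring

theorem pdC_add {f g : (Fin 3 → ℝ) → ℂ} {x : Fin 3 → ℝ} (hf : DifferentiableAt ℝ f x)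
    (hg : DifferentiableAt ℝ g x) (i : Fin 3) :
    pdC (fun y => f y + g y) i x = pdC f i x + pdC g i x := by
  unfold pdC
  rw [fderiv_fun_add hf hg]
  simp

theorem pdC_sub {f g : (Fin 3 → ℝ) → ℂ} {x : Fin 3 → ℝ} (hf : DifferentiableAt ℝ f x)
    (hg : DifferentiableAt ℝ g x) (i : Fin 3) :
    pdC (fun y => f y - g y) i x = pdC f i x - pdC g i x := by
  unfold pdC
  rw [fderiv_fun_sub hf hg]
  simp

theorem pdC_diff0 {f : (Fin 3 → ℝ) → ℂ} {Ω : Set (Fin 3 → ℝ)} (hΩ : IsOpen Ω)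
    (hf : ContDiffOn ℝ 2 f Ω) {x : Fin 3 → ℝ} (hx : x ∈ Ω) : DifferentiableAt ℝ f x :=
  (hf.contDiffAt (hΩ.mem_nhds hx)).differentiableAt (by norm_num)

theorem pdC_fdiff {f : (Fin 3 → ℝ) → ℂ} {Ω : Set (Fin 3 → ℝ)} (hΩ : IsOpen Ω)
    (hf : ContDiffOn ℝ 2 f Ω) {x : Fin 3 → ℝ} (hx : x ∈ Ω) :
    DifferentiableAt ℝ (fderiv ℝ f) x :=
  ((hf.contDiffAt (hΩ.mem_nhds hx)).fderiv_right (m := 1) (by norm_num)).differentiableAt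
    (by norm_num)

theorem pdC_diff1 {f : (Fin 3 → ℝ) → ℂ} {Ω : Set (Fin 3 → ℝ)} (hΩ : IsOpen Ω)
    (hf : ContDiffOn ℝ 2 f Ω) {x : Fin 3 → ℝ} (hx : x ∈ Ω) (i : Fin 3) :
    DifferentiableAt ℝ (pdC f i) x :=
  (pdC_fdiff hΩ hf hx).clm_apply (differentiableAt_const _)

theorem pdC_symm {f : (Fin 3 → ℝ) → ℂ} {Ω : Set (Fin 3 → ℝ)} (hΩ : IsOpen Ω)
    (hf : ContDiffOn ℝ 2 f Ω) {x : Fin 3 → ℝ} (hx : x ∈ Ω) (i j : Fin 3) :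
    pdC (pdC f i) j x = pdC (pdC f j) i x := by
  have key : ∀ i j : Fin 3, pdC (pdC f i) j x
      = fderiv ℝ (fderiv ℝ f) x (Pi.single j 1) (Pi.single i 1) := by
    intro i j
    have h : HasFDerivAt (pdC f i) _ x :=
      (pdC_fdiff hΩ hf hx).hasFDerivAt.clm_apply (hasFDerivAt_const (Pi.single i 1) x)
    rw [pdC, h.fderiv]
    simp
  have hs : IsSymmSndFDerivAt ℝ f x :=
    (hf.contDiffAt (hΩ.mem_nhds hx)).isSymmSndFDerivAt (by simp)
  rw [key, key]
  exact hs _ _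

theorem pdC_pdC_mul {f g : (Fin 3 → ℝ) → ℂ} {Ω : Set (Fin 3 → ℝ)} (hΩ : IsOpen Ω)
    (hf : ContDiffOn ℝ 2 f Ω) (hg : ContDiffOn ℝ 2 g Ω) {x : Fin 3 → ℝ} (hx : x ∈ Ω)
    (i j : Fin 3) :
    pdC (pdC (fun y => f y * g y) i) j x
      = pdC (pdC f i) j x * g x + pdC f i x * pdC g j x
        + (pdC f j x * pdC g i x + f x * pdC (pdC g i) j x) := by
  rw [pdC_congr hΩ (fun y hy => pdC_mul (pdC_diff0 hΩ hf hy) (pdC_diff0 hΩ hg hy) i) j hx,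
    pdC_add ((pdC_diff1 hΩ hf hx i).fun_mul (pdC_diff0 hΩ hg hx))
      ((pdC_diff0 hΩ hf hx).fun_mul (pdC_diff1 hΩ hg hx i)),
    pdC_mul (pdC_diff1 hΩ hf hx i) (pdC_diff0 hΩ hg hx),
    pdC_mul (pdC_diff0 hΩ hf hx) (pdC_diff1 hΩ hg hx i)]

theorem pdC_divC {H : (Fin 3 → ℝ) → Fin 3 → ℂ} {Ω : Set (Fin 3 → ℝ)} (hΩ : IsOpen Ω)
    (hH : ∀ i, ContDiffOn ℝ 2 (fun y => H y i) Ω) {x : Fin 3 → ℝ} (hx : x ∈ Ω) (j : Fin 3) :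
    pdC (divC H) j x = pdC (pdC (fun y => H y 0) 0) j x + pdC (pdC (fun y => H y 1) 1) j x
      + pdC (pdC (fun y => H y 2) 2) j x := by
  have h0 : divC H = fun y => (pdC (fun y => H y 0) 0 y + pdC (fun y => H y 1) 1 y)
      + pdC (fun y => H y 2) 2 y := by
    funext y
    simp [divC, Fin.sum_univ_three]
  have d := fun i => pdC_diff1 hΩ (hH i) hx i
  rw [h0, pdC_add ((d 0).fun_add (d 1)) (d 2), pdC_add (d 0) (d 1)]

theorem curl_curl_eq {E : (Fin 3 → ℝ) → Fin 3 → ℂ} {Ω : Set (Fin 3 → ℝ)} (hΩ : IsOpen Ω)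
    (hE : ∀ i, ContDiffOn ℝ 2 (fun y => E y i) Ω) {x : Fin 3 → ℝ} (hx : x ∈ Ω) (j : Fin 3) :
    curlC (fun y => curlC E y) x j = pdC (divC E) j x - lapC (fun y => E y j) x := by
  have d := fun i k => pdC_diff1 hΩ (hE i) hx k
  have s := fun i k l => pdC_symm hΩ (hE i) hx k l
  rw [pdC_divC hΩ hE hx]
  fin_cases j
  · simp [curlC, lapC, Fin.sum_univ_three]
    rw [pdC_sub (d _ _) (d _ _), pdC_sub (d _ _) (d _ _), s 1 0 1, s 2 0 2]
    ring
  · simp [curlC, lapC, Fin.sum_univ_three]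
    rw [pdC_sub (d _ _) (d _ _), pdC_sub (d _ _) (d _ _), s 2 1 2, s 0 1 0]
    ring
  · simp [curlC, lapC, Fin.sum_univ_three]
    rw [pdC_sub (d _ _) (d _ _), pdC_sub (d _ _) (d _ _), s 0 2 0, s 1 2 1]
    ring

/-- If `E₁, E₂` solve `∇×(∇×E) = κ²nE` in `Ω` and `H_j := L E_j` with `L` nowhere vanishing,
then the transport identity `β·∇L = γL` holds in `Ω`. -/
theorem es_transport_identity (Ω : Set (Fin 3 → ℝ)) (hΩ : IsOpen Ω)
    (nn : (Fin 3 → ℝ) → ℂ) (hn : ContinuousOn nn Ω) (κ : ℝ)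
    (E₁ E₂ : (Fin 3 → ℝ) → Fin 3 → ℂ)
    (hE₁ : ContDiffOn ℝ 2 E₁ Ω) (hE₂ : ContDiffOn ℝ 2 E₂ Ω)
    (hM₁ : ∀ x ∈ Ω, ∀ i, curlC (fun y => curlC E₁ y) x i = (κ : ℂ) ^ 2 * nn x * E₁ x i)
    (hM₂ : ∀ x ∈ Ω, ∀ i, curlC (fun y => curlC E₂ y) x i = (κ : ℂ) ^ 2 * nn x * E₂ x i)
    (L : (Fin 3 → ℝ) → ℂ) (hL : ContDiffOn ℝ 2 L Ω) (hL0 : ∀ x ∈ Ω, L x ≠ 0)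
    (H₁ H₂ : (Fin 3 → ℝ) → Fin 3 → ℂ)
    (hH₁ : ∀ x i, H₁ x i = L x * E₁ x i) (hH₂ : ∀ x i, H₂ x i = L x * E₂ x i) :
    ∀ x ∈ Ω, (∑ i, esBeta H₁ H₂ x i * pdC L i x) = esGamma H₁ H₂ x * L x := by
  intro x hx
  have e₁ : ∀ i, ContDiffOn ℝ 2 (fun y => E₁ y i) Ω := fun i => contDiffOn_pi.1 hE₁ i
  have e₂ : ∀ i, ContDiffOn ℝ 2 (fun y => E₂ y i) Ω := fun i => contDiffOn_pi.1 hE₂ i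
  obtain rfl : H₁ = fun y i => L y * E₁ y i := by funext y i; exact hH₁ y i
  obtain rfl : H₂ = fun y i => L y * E₂ y i := by funext y i; exact hH₂ y i
  have h₁ : ∀ i, ContDiffOn ℝ 2 (fun y => L y * E₁ y i) Ω := fun i => hL.mul (e₁ i)
  have h₂ : ∀ i, ContDiffOn ℝ 2 (fun y => L y * E₂ y i) Ω := fun i => hL.mul (e₂ i)
  have m₁ := fun i => hM₁ x hx i
  have m₂ := fun i => hM₂ x hx i
  simp only [curl_curl_eq hΩ e₁ hx, pdC_divC hΩ e₁ hx, lapC, Fin.sum_univ_three] at m₁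
  simp only [curl_curl_eq hΩ e₂ hx, pdC_divC hΩ e₂ hx, lapC, Fin.sum_univ_three] at m₂
  have p₁ := fun i k => pdC_mul (pdC_diff0 hΩ hL hx) (pdC_diff0 hΩ (e₁ i) hx) k
  have p₂ := fun i k => pdC_mul (pdC_diff0 hΩ hL hx) (pdC_diff0 hΩ (e₂ i) hx) k
  have q₁ := fun i k l => pdC_pdC_mul hΩ hL (e₁ i) hx k l
  have q₂ := fun i k l => pdC_pdC_mul hΩ hL (e₂ i) hx k l
  simp only [esBeta, esGamma, pdC_divC hΩ h₁ hx, pdC_divC hΩ h₂ hx]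
  simp only [divC, lapC, Fin.sum_univ_three, p₁, p₂, q₁, q₂]
  rw [pdC_symm hΩ hL hx 1 0, pdC_symm hΩ hL hx 2 0, pdC_symm hΩ hL hx 2 1]
  linear_combination (-(L x) ^ 3) * (m₁ 0 * E₂ x 0 + m₁ 1 * E₂ x 1 + m₁ 2 * E₂ x 2
    - m₂ 0 * E₁ x 0 - m₂ 1 * E₁ x 1 - m₂ 2 * E₁ x 2)
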